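/- Let C_a > 0, θ ≥ 0 and let g : 𝕋 → ℝ be continuous; set a := C_a + θg and assume a is even and a(x) > 0 for all x ∈ 𝕋. Let v̄ > 0, T > 0, let w : 𝕋 × [0,T] → ℝ be smooth with 0 < w_min ≤ w(x,t) ≤ w_max for all (x,t), and let (ρ, j) be a classical solution of the weighted reduced Cucker–Smale PDE with kernel a, parameter v̄ and weight w on [0,T], satisfying ∫_𝕋 ρ(x,0)dx = 1 and ∫_𝕋 j(x,0)dx = v̄. Let Q > 0 satisfy 8θ‖g‖Q < C_a and suppose v̄²‖ρ(·,t)‖² + ‖j(·,t)‖² ≤ v̄²Q² for all t ∈ [0,T]. Define β̃(s) := 2v̄²Q²( v̄‖∂_x w(·,s)‖_∞ + ‖∂_t w(·,s)‖_∞ ) + v̄²θ‖g‖Q³‖1 − w(·,s)‖_∞ and β(t) := 2e^{−C_a t}∫₀ᵗ e^{C_a s} β̃(s) ds + v̄²‖w(·,t) − 1‖_∞² Q². Then for all t ∈ [0,T]: ‖j(·,t) − v̄ρ(·,t)‖² ≤ 2|⟨ j(·,0) − v̄ρ(·,0), j(·,0) − v̄ w(·,0)ρ(·,0) ⟩| e^{−C_a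 t} + β(t). -/

import Mathlib

open Real MeasureTheory

/-- Convolution on the torus `ℝ/2πℤ`, with functions represented as `2π`-periodic
functions on `ℝ` and the integral taken over one period. -/
noncomputable def conv1 (f h : ℝ → ℝ) (x : ℝ) : ℝ :=
  ∫ y in (0:ℝ)..(2*π), f (x - y) * h y

/-- `L²(𝕋)` inner product. -/
noncomputable def ip (f h : ℝ → ℝ) : ℝ :=
  ∫ x in (0:ℝ)..(2*π), f x * h x

/-- `L²(𝕋)` norm. -/
noncomputable def nrm (f : ℝ → ℝ) : ℝ := Real.sqrt (ip f f)

/-- Supremum norm of a function on the torus (represented as a function on `ℝ`). -/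
noncomputable def supNorm (f : ℝ → ℝ) : ℝ := ⨆ x : ℝ, |f x|

/-- A classical solution of the weighted reduced Cucker-Smale PDE with kernel `a`,
parameter `vbar` and weight `w` on the time interval `I`: smooth `2π`-periodic-in-`x`
functions `ρ, j` satisfying `∂ₜρ = −∂ₓj` and `∂ₜj = ρ(a∗j) − j(a∗ρ) − vbar²∂ₓ(wρ)`. -/
structure IsWeightedSol (a : ℝ → ℝ) (vbar : ℝ) (w ρ j : ℝ → ℝ → ℝ) (I : Set ℝ) : Prop where
  periodic_rho : ∀ t ∈ I, Function.Periodic (fun x => ρ x t) (2*π)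
  periodic_j : ∀ t ∈ I, Function.Periodic (fun x => j x t) (2*π)
  smooth_rho : ContDiffOn ℝ (⊤ : ℕ∞) (fun p : ℝ × ℝ => ρ p.1 p.2) (Set.univ ×ˢ I)
  smooth_j : ContDiffOn ℝ (⊤ : ℕ∞) (fun p : ℝ × ℝ => j p.1 p.2) (Set.univ ×ˢ I)
  pde_rho : ∀ (x : ℝ), ∀ t ∈ I,
    derivWithin (fun s => ρ x s) I t = - deriv (fun y => j y t) x
  pde_j : ∀ (x : ℝ), ∀ t ∈ I,
    derivWithin (fun s => j x s) I t =
      ρ x t * conv1 a (fun y => j y t) x - j x t * conv1 a (fun y => ρ y t) x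
        - vbar ^ 2 * deriv (fun y => w y t * ρ y t) x



lemma aux_reg (f : ℝ → ℝ → ℝ) (T : ℝ) (hT : 0 < T)
    (hf : ContDiffOn ℝ (⊤ : ℕ∞) (fun p : ℝ × ℝ => f p.1 p.2) (Set.univ ×ˢ Set.Icc (0:ℝ) T)) :
    (∀ x, ∀ t ∈ Set.Icc (0:ℝ) T, HasDerivAt (fun y => f y t) (deriv (fun y => f y t) x) x) ∧
    (∀ x, ∀ t ∈ Set.Icc (0:ℝ) T, HasDerivWithinAt (fun s => f x s)
      (derivWithin (fun s => f x s) (Set.Icc (0:ℝ) T) t) (Set.Icc (0:ℝ) T) t) ∧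
    ContinuousOn (fun p : ℝ × ℝ => deriv (fun y => f y p.2) p.1) (Set.univ ×ˢ Set.Icc (0:ℝ) T) ∧
    ContinuousOn (fun p : ℝ × ℝ => derivWithin (fun s => f p.1 s) (Set.Icc (0:ℝ) T) p.2)
      (Set.univ ×ˢ Set.Icc (0:ℝ) T) := by
  set S : Set (ℝ × ℝ) := Set.univ ×ˢ Set.Icc (0:ℝ) T with hS
  have hU : UniqueDiffOn ℝ S := uniqueDiffOn_univ.prod (uniqueDiffOn_Icc hT)
  have hc := hf.continuousOn_fderivWithin hU (by simp)
  have hd : ∀ p ∈ S, HasFDerivWithinAt (fun p : ℝ × ℝ => f p.1 p.2)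
      (fderivWithin ℝ (fun p : ℝ × ℝ => f p.1 p.2) S p) S p := fun p hp =>
    ((hf.differentiableOn (by simp)) p hp).hasFDerivWithinAt
  have h1 : ∀ x, ∀ t ∈ Set.Icc (0:ℝ) T, HasDerivAt (fun y => f y t)
      (fderivWithin ℝ (fun p : ℝ × ℝ => f p.1 p.2) S (x, t) (1, 0)) x := by
    intro x t ht
    have hp : ((x, t) : ℝ × ℝ) ∈ S := ⟨trivial, ht⟩
    have hl : HasDerivWithinAt (fun y : ℝ => ((y, t) : ℝ × ℝ)) (1, 0) Set.univ x :=
      ((hasDerivAt_id x).prodMk (hasDerivAt_const x t)).hasDerivWithinAt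
    have := (hd (x, t) hp).comp_hasDerivWithinAt x hl (fun y _ => Set.mk_mem_prod trivial ht)
    simpa [Function.comp_def] using this
  have h2 : ∀ x, ∀ t ∈ Set.Icc (0:ℝ) T, HasDerivWithinAt (fun s => f x s)
      (fderivWithin ℝ (fun p : ℝ × ℝ => f p.1 p.2) S (x, t) (0, 1)) (Set.Icc (0:ℝ) T) t := by
    intro x t ht
    have hp : ((x, t) : ℝ × ℝ) ∈ S := ⟨trivial, ht⟩
    have hl : HasDerivWithinAt (fun s : ℝ => ((x, s) : ℝ × ℝ)) (0, 1) (Set.Icc (0:ℝ) T) t :=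
      ((hasDerivAt_const t x).prodMk (hasDerivAt_id t)).hasDerivWithinAt
    exact (hd (x, t) hp).comp_hasDerivWithinAt t hl (fun y hy => ⟨trivial, hy⟩)
  refine ⟨fun x t ht => ?_, fun x t ht => ?_, ?_, ?_⟩
  · exact (h1 x t ht).differentiableAt.hasDerivAt
  · exact (h2 x t ht).differentiableWithinAt.hasDerivWithinAt
  · refine (hc.clm_apply (continuousOn_const (c := ((1, 0) : ℝ × ℝ)))).congr ?_
    rintro ⟨x, t⟩ ⟨_, ht⟩
    exact (h1 x t ht).deriv
  · refine (hc.clm_apply (continuousOn_const (c := ((0, 1) : ℝ × ℝ)))).congr ?_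
    rintro ⟨x, t⟩ ⟨_, ht⟩
    exact (h2 x t ht).derivWithin (uniqueDiffOn_Icc hT t ht)

lemma aux_clamp (F : ℝ → ℝ → ℝ) (T : ℝ) (hT : 0 < T)
    (hF : ContinuousOn (fun p : ℝ × ℝ => F p.1 p.2) (Set.univ ×ˢ Set.Icc (0:ℝ) T)) :
    Continuous (fun p : ℝ × ℝ => F p.2 (Set.projIcc 0 T hT.le p.1)) := by
  have hm : Continuous (fun p : ℝ × ℝ => ((p.2, (Set.projIcc 0 T hT.le p.1 : ℝ)) : ℝ × ℝ)) :=
    continuous_snd.prodMk (continuous_subtype_val.comp (continuous_projIcc.comp continuous_fst))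
  exact hF.comp_continuous hm (fun p => ⟨trivial, (Set.projIcc 0 T hT.le p.1).2⟩)

lemma aux_slice (F : ℝ → ℝ → ℝ) (T : ℝ)
    (hF : ContinuousOn (fun p : ℝ × ℝ => F p.1 p.2) (Set.univ ×ˢ Set.Icc (0:ℝ) T))
    (t : ℝ) (ht : t ∈ Set.Icc (0:ℝ) T) : Continuous (fun x => F x t) :=
  hF.comp_continuous (f := fun x : ℝ => ((x, t) : ℝ × ℝ)) (by fun_prop) (fun x => ⟨trivial, ht⟩)

lemma aux_cont_int (F : ℝ → ℝ → ℝ) (T : ℝ) (hT : 0 < T)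
    (hF : ContinuousOn (fun p : ℝ × ℝ => F p.1 p.2) (Set.univ ×ˢ Set.Icc (0:ℝ) T)) :
    ContinuousOn (fun t => ∫ x in (0:ℝ)..(2*π), F x t) (Set.Icc 0 T) := by
  have h := aux_clamp F T hT hF
  have h2 := intervalIntegral.continuous_parametric_intervalIntegral_of_continuous'
    (μ := volume) (f := fun t x => F x (Set.projIcc 0 T hT.le t)) h 0 (2*π)
  refine h2.continuousOn.congr ?_
  intro t ht
  simp only [Set.projIcc_of_mem hT.le ht]

lemma aux_deriv_int (F Ft : ℝ → ℝ → ℝ) (T : ℝ) (hT : 0 < T)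
    (hF : ContinuousOn (fun p : ℝ × ℝ => F p.1 p.2) (Set.univ ×ˢ Set.Icc (0:ℝ) T))
    (hFt : ContinuousOn (fun p : ℝ × ℝ => Ft p.1 p.2) (Set.univ ×ˢ Set.Icc (0:ℝ) T))
    (hd : ∀ x, ∀ t ∈ Set.Icc (0:ℝ) T, HasDerivWithinAt (fun s => F x s) (Ft x t)
      (Set.Icc (0:ℝ) T) t) (t : ℝ) (ht : t ∈ Set.Ioo 0 T) :
    HasDerivAt (fun t => ∫ x in (0:ℝ)..(2*π), F x t) (∫ x in (0:ℝ)..(2*π), Ft x t) t := by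
  have hK : IsCompact (Set.Icc (0:ℝ) (2*π) ×ˢ Set.Icc (0:ℝ) T) := isCompact_Icc.prod isCompact_Icc
  obtain ⟨C, hC⟩ := hK.exists_bound_of_continuousOn
    (hFt.mono (Set.prod_mono (Set.subset_univ _) le_rfl))
  have hpi : (0:ℝ) ≤ 2*π := by positivity
  have hIoo : Set.Ioo 0 T ∈ nhds t := Ioo_mem_nhds ht.1 ht.2
  refine (intervalIntegral.hasDerivAt_integral_of_dominated_loc_of_deriv_le (μ := volume)
    (F := fun t x => F x t) (F' := fun t x => Ft x t) (bound := fun _ => C) (s := Set.Ioo 0 T)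
    hIoo ?_ ?_ ?_ ?_ ?_ ?_).2
  · filter_upwards [hIoo] with s hs
    exact (aux_slice F T hF s (Set.Ioo_subset_Icc_self hs)).aestronglyMeasurable
  · exact (aux_slice F T hF t (Set.Ioo_subset_Icc_self ht)).intervalIntegrable _ _
  · exact (aux_slice Ft T hFt t (Set.Ioo_subset_Icc_self ht)).aestronglyMeasurable
  · refine Filter.Eventually.of_forall fun x hx s hs => ?_
    rw [Set.uIoc_of_le hpi] at hx
    exact hC (x, s) ⟨Set.Ioc_subset_Icc_self hx, Set.Ioo_subset_Icc_self hs⟩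
  · exact intervalIntegrable_const
  · refine Filter.Eventually.of_forall fun x hx s hs => ?_
    exact (hd x s (Set.Ioo_subset_Icc_self hs)).hasDerivAt (Icc_mem_nhds hs.1 hs.2)

lemma aux_sup_le (f : ℝ → ℝ) (hf : Continuous f) (hp : Function.Periodic f (2*π)) (x : ℝ) :
    |f x| ≤ supNorm f := by
  have hp' : Function.Periodic (fun x => |f x|) (2*π) := fun x => by simp [hp x]
  have hb := hp'.isBounded_of_continuous (by positivity) hf.abs
  exact le_ciSup hb.bddAbove x

lemma aux_sup_cont (F : ℝ → ℝ → ℝ) (T : ℝ) (hT : 0 < T)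
    (hF : ContinuousOn (fun p : ℝ × ℝ => F p.1 p.2) (Set.univ ×ˢ Set.Icc (0:ℝ) T))
    (hp : ∀ t ∈ Set.Icc (0:ℝ) T, Function.Periodic (fun x => F x t) (2*π)) :
    ContinuousOn (fun t => supNorm (fun x => F x t)) (Set.Icc 0 T) := by
  have h := (aux_clamp F T hT hF).abs
  have h2 := (isCompact_Icc (a := (0:ℝ)) (b := 2*π)).continuous_sSup
    (f := fun t x => |F x (Set.projIcc 0 T hT.le t)|) h
  refine h2.continuousOn.congr ?_
  intro t ht
  have hp' : Function.Periodic (fun x => |F x t|) (2*π) := fun x => by simp [hp t ht x]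
  have := hp'.image_Icc (by positivity) 0
  simp only [Set.projIcc_of_mem hT.le ht, supNorm]
  rw [zero_add] at this
  rw [this, iSup]

lemma aux_gronwall (E E' b : ℝ → ℝ) (C T : ℝ) (hT : 0 < T)
    (hE : ContinuousOn E (Set.Icc 0 T)) (hb : ContinuousOn b (Set.Icc 0 T))
    (hd : ∀ t ∈ Set.Ioo 0 T, HasDerivAt E (E' t) t)
    (hle : ∀ t ∈ Set.Ioo 0 T, E' t ≤ -C * E t + b t) (t : ℝ) (ht : t ∈ Set.Icc 0 T) :
    E t ≤ Real.exp (-C * t) * (E 0 + ∫ s in (0:ℝ)..t, Real.exp (C * s) * b s) := by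
  set bc : ℝ → ℝ := fun s => b (Set.projIcc 0 T hT.le s) with hbc
  have hbcc : Continuous bc := hb.comp_continuous
    (continuous_subtype_val.comp continuous_projIcc) (fun s => (Set.projIcc 0 T hT.le s).2)
  have hbe : ∀ s ∈ Set.Icc 0 T, bc s = b s := fun s hs => by
    simp only [hbc, Set.projIcc_of_mem hT.le hs]
  have hint : ∫ s in (0:ℝ)..t, Real.exp (C * s) * b s = ∫ s in (0:ℝ)..t, Real.exp (C * s) * bc s := by
    apply intervalIntegral.integral_congr
    intro s hs
    rw [Set.uIcc_of_le ht.1] at hs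
    simp only [hbe s ⟨hs.1, hs.2.trans ht.2⟩]
  have hcont : Continuous (fun s => Real.exp (C * s) * bc s) := by fun_prop
  have hG : ∀ t, HasDerivAt (fun t => ∫ s in (0:ℝ)..t, Real.exp (C * s) * bc s)
      (Real.exp (C * t) * bc t) t := fun t => (hcont.integral_hasStrictDerivAt 0 t).hasDerivAt
  have hH : ∀ t ∈ Set.Ioo 0 T, HasDerivAt
      (fun t => Real.exp (C * t) * E t - ∫ s in (0:ℝ)..t, Real.exp (C * s) * bc s)
      ((Real.exp (C * t) * C) * E t + Real.exp (C * t) * E' t - Real.exp (C * t) * bc t) t := by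
    intro t ht
    have he : HasDerivAt (fun t => Real.exp (C * t)) (Real.exp (C * t) * C) t := by
      simpa using ((hasDerivAt_id t).const_mul C).exp
    exact (he.mul (hd t ht)).sub (hG t)
  have hanti : AntitoneOn (fun t => Real.exp (C * t) * E t -
      ∫ s in (0:ℝ)..t, Real.exp (C * s) * bc s) (Set.Icc 0 T) := by
    apply antitoneOn_of_deriv_nonpos (convex_Icc 0 T)
    · refine ContinuousOn.sub (ContinuousOn.mul (by fun_prop) hE) ?_
      exact (continuous_iff_continuousAt.2 fun t => (hG t).continuousAt).continuousOn
    · rw [interior_Icc]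
      exact fun t ht => (hH t ht).differentiableAt.differentiableWithinAt
    · rw [interior_Icc]
      intro t ht
      rw [(hH t ht).deriv, hbe t (Set.Ioo_subset_Icc_self ht)]
      nlinarith [hle t ht, Real.exp_pos (C * t)]
  have := hanti (Set.left_mem_Icc.2 hT.le) ht ht.1
  simp only [mul_zero, Real.exp_zero, one_mul, intervalIntegral.integral_same, sub_zero] at this
  rw [hint]
  have e1 : Real.exp (-C * t) * Real.exp (C * t) = 1 := by
    rw [← Real.exp_add]; simp
  calc E t = Real.exp (-C * t) * (Real.exp (C * t) * E t) := by rw [← mul_assoc, e1, one_mul]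
    _ ≤ _ := mul_le_mul_of_nonneg_left (by linarith) (Real.exp_pos _).le

lemma aux_ii {f : ℝ → ℝ} (hf : Continuous f) : IntervalIntegrable f volume 0 (2*π) :=
  hf.intervalIntegrable _ _

lemma aux_ip_nonneg (f : ℝ → ℝ) : 0 ≤ ip f f :=
  intervalIntegral.integral_nonneg (by positivity) (fun x _ => mul_self_nonneg _)

lemma aux_nrm_sq (f : ℝ → ℝ) : nrm f ^ 2 = ip f f := Real.sq_sqrt (aux_ip_nonneg f)

lemma aux_nrm_nonneg (f : ℝ → ℝ) : 0 ≤ nrm f := Real.sqrt_nonneg _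

lemma aux_cs (f h : ℝ → ℝ) (hf : Continuous f) (hh : Continuous h) :
    |∫ x in (0:ℝ)..(2*π), f x * h x| ≤ nrm f * nrm h := by
  have key : ∀ l : ℝ, 0 ≤ ip h h * (l * l) + (2 * ip f h) * l + ip f f := by
    intro l
    have h0 : 0 ≤ ip (fun x => f x + l * h x) (fun x => f x + l * h x) := aux_ip_nonneg _
    have : ip (fun x => f x + l * h x) (fun x => f x + l * h x)
        = ip h h * (l * l) + (2 * ip f h) * l + ip f f := by
      unfold ip
      rw [← intervalIntegral.integral_mul_const, ← intervalIntegral.integral_const_mul,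
        ← intervalIntegral.integral_mul_const,
        ← intervalIntegral.integral_add (aux_ii (by fun_prop)) (aux_ii (by fun_prop)),
        ← intervalIntegral.integral_add (aux_ii (by fun_prop)) (aux_ii (by fun_prop))]
      apply intervalIntegral.integral_congr
      intro x _
      ring
    linarith
  have hd := discrim_le_zero key
  unfold discrim at hd
  apply abs_le_of_sq_le_sq _ (mul_nonneg (aux_nrm_nonneg _) (aux_nrm_nonneg _))
  rw [mul_pow, aux_nrm_sq, aux_nrm_sq]
  change (ip f h)^2 ≤ _
  nlinarith

lemma aux_cs_abs (f h : ℝ → ℝ) (hf : Continuous f) (hh : Continuous h) :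
    ∫ x in (0:ℝ)..(2*π), |f x| * |h x| ≤ nrm f * nrm h := by
  have := (le_abs_self _).trans (aux_cs (fun x => |f x|) (fun x => |h x|) hf.abs hh.abs)
  simpa [nrm, ip] using this

lemma aux_conv (g f : ℝ → ℝ) (hg : Continuous g) (hp : Function.Periodic g (2*π))
    (hf : Continuous f) (x : ℝ) : |conv1 g f x| ≤ nrm g * nrm f := by
  have h := aux_cs (fun y => g (x - y)) f (by fun_prop) hf
  have : nrm (fun y => g (x - y)) = nrm g := by
    unfold nrm ip
    congr 1
    rw [intervalIntegral.integral_comp_sub_left (fun y => g y * g y) x]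
    have hp2 : Function.Periodic (fun y => g y * g y) (2*π) := fun y => by simp [hp y]
    have := hp2.intervalIntegral_add_eq (x - 2*π) 0
    simpa using this
  rw [this] at h
  exact h

lemma aux_conv_cont (g f : ℝ → ℝ) (hg : Continuous g) (hf : Continuous f) :
    Continuous (conv1 g f) := by
  unfold conv1
  apply intervalIntegral.continuous_parametric_intervalIntegral_of_continuous'
  simp only [Function.uncurry_def]
  fun_prop

lemma aux_conv_swap (a f h : ℝ → ℝ) (ha : Continuous a) (he : ∀ x, a (-x) = a x)
    (hf : Continuous f) (hh : Continuous h) :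
    ∫ x in (0:ℝ)..(2*π), f x * conv1 a h x = ∫ x in (0:ℝ)..(2*π), h x * conv1 a f x := by
  unfold conv1
  simp only [← intervalIntegral.integral_const_mul]
  rw [MeasureTheory.intervalIntegral_intervalIntegral_swap]
  · apply intervalIntegral.integral_congr
    intro y _
    apply intervalIntegral.integral_congr
    intro x _
    simp only
    rw [← he (x - y)]
    ring_nf
  · have hc : Continuous (Function.uncurry fun x y => f x * (a (x - y) * h y)) := by
      simp only [Function.uncurry_def]; fun_prop
    exact (hc.continuousOn.integrableOn_compact (isCompact_uIcc.prod isCompact_uIcc)).mono_set (Set.prod_mono Set.uIoc_subset_uIcc Set.uIoc_subset_uIcc)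

lemma aux_algebra (v Q G θ Ca nr nJ nA S1 S2 S3 : ℝ) (hv : 0 < v) (hQ : 0 < Q) (hG : 0 ≤ G)
    (hθ : 0 ≤ θ) (hr : 0 ≤ nr) (hJ : 0 ≤ nJ) (hS1 : 0 ≤ S1) (hS2 : 0 ≤ S2)
    (hS3 : 0 ≤ S3) (hsm : 8 * θ * G * Q < Ca) (hen : v ^ 2 * nr ^ 2 + nJ ^ 2 ≤ v ^ 2 * Q ^ 2) :
    -Ca * nA ^ 2 + 2 * θ * G * (nA * (nr * nA) + nr * nA ^ 2)
      + θ * v * S3 * G * (nJ * nr ^ 2 + nr * (nJ * nr))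
      + S2 * (3/2 * v ^ 2 * nr ^ 2 + 1/2 * nJ ^ 2)
      + 1/2 * v * S1 * (nJ ^ 2 + v ^ 2 * nr ^ 2)
    ≤ 2 * v ^ 2 * Q ^ 2 * (v * S1 + S2) + v ^ 2 * θ * G * Q ^ 3 * S3 := by
  have hnr : nr ≤ Q := by
    have : (v * nr) ^ 2 ≤ (v * Q) ^ 2 := by nlinarith [sq_nonneg nJ]
    have := abs_le_of_sq_le_sq this (by positivity)
    rw [abs_of_nonneg (by positivity)] at this
    exact le_of_mul_le_mul_left this hv
  have hGθ : 0 ≤ θ * G := mul_nonneg hθ hG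
  have h1 : -Ca * nA ^ 2 + 2 * θ * G * (nA * (nr * nA) + nr * nA ^ 2) ≤ 0 := by
    have : 4 * (θ * G) * nr ≤ Ca := by
      nlinarith [mul_le_mul_of_nonneg_left hnr hGθ, mul_nonneg hGθ hQ.le]
    nlinarith [sq_nonneg nA]
  have h2 : 2 * nJ * nr ^ 2 ≤ v * Q ^ 3 := by
    -- `v² nr² ≤ v² Q² - nJ²`; then `2 s (q² - s²) ≤ q³` with `s = nJ`, `q = v Q`.
    have hq : 0 < v * Q := by positivity
    have e1 : 2 * nJ * (v ^ 2 * nr ^ 2) ≤ 2 * nJ * ((v * Q) ^ 2 - nJ ^ 2) :=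
      mul_le_mul_of_nonneg_left (by nlinarith) (by positivity)
    have e2 : 2 * nJ * ((v * Q) ^ 2 - nJ ^ 2) ≤ (v * Q) ^ 3 := by
      generalize v * Q = q at hq
      nlinarith [mul_nonneg hq.le (sq_nonneg (nJ - 3/5 * q)), mul_nonneg hJ (sq_nonneg (nJ - 3/5 * q)), pow_pos hq 3, mul_nonneg hJ (sq_nonneg q)]
    have : v ^ 2 * (2 * nJ * nr ^ 2) ≤ v ^ 2 * (v * Q ^ 3) := by nlinarith
    exact le_of_mul_le_mul_left this (by positivity)
  have h3 : θ * v * S3 * G * (nJ * nr ^ 2 + nr * (nJ * nr)) ≤ v ^ 2 * θ * G * Q ^ 3 * S3 := by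
    have : 0 ≤ θ * G * (v * S3) := by positivity
    nlinarith [mul_le_mul_of_nonneg_left h2 this]
  have h4 : S2 * (3/2 * v ^ 2 * nr ^ 2 + 1/2 * nJ ^ 2) ≤ S2 * (2 * v ^ 2 * Q ^ 2) :=
    mul_le_mul_of_nonneg_left (by nlinarith [sq_nonneg nJ, sq_nonneg (v * nr)]) hS2
  have h5 : 1/2 * v * S1 * (nJ ^ 2 + v ^ 2 * nr ^ 2) ≤ 1/2 * v * S1 * (4 * v ^ 2 * Q ^ 2) :=
    mul_le_mul_of_nonneg_left (by nlinarith [sq_nonneg nJ, sq_nonneg (v * nr)]) (by positivity)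
  linarith

lemma aux_conv_lin (g f h : ℝ → ℝ) (c : ℝ) (hg : Continuous g) (hf : Continuous f)
    (hh : Continuous h) (x : ℝ) :
    conv1 g (fun y => f y - c * h y) x = conv1 g f x - c * conv1 g h x := by
  unfold conv1
  rw [← intervalIntegral.integral_const_mul, ← intervalIntegral.integral_sub
    (aux_ii (by fun_prop)) (aux_ii (by fun_prop))]
  apply intervalIntegral.integral_congr
  intro y _
  ring

lemma aux_conv_const (g f : ℝ → ℝ) (c θ : ℝ) (hg : Continuous g) (hf : Continuous f) (x : ℝ) :
    conv1 (fun x => c + θ * g x) f x = c * (∫ y in (0:ℝ)..(2*π), f y) + θ * conv1 g f x := by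
  unfold conv1
  rw [← intervalIntegral.integral_const_mul, ← intervalIntegral.integral_const_mul,
    ← intervalIntegral.integral_add (aux_ii (by fun_prop)) (aux_ii (by fun_prop))]
  apply intervalIntegral.integral_congr
  intro y _
  ring

lemma aux_point (r J W r' J' W' Wt gr gJ v θ Ca G nr nJ nA S1 S2 S3 : ℝ) (hv : 0 < v)
    (hθ : 0 ≤ θ)
    (hgA : |gJ - v * gr| ≤ G * nA) (hgr : |gr| ≤ G * nr) (hgJ : |gJ| ≤ G * nJ)
    (hW' : |W'| ≤ S1) (hWt : |Wt| ≤ S2) (hW : |1 - W| ≤ S3) :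
    ((r * (Ca * v + θ * gJ) - J * (Ca * 1 + θ * gr) - v ^ 2 * (W' * r + W * r')) - v * (-J'))
        * (J - v * W * r)
      + (J - v * r) * ((r * (Ca * v + θ * gJ) - J * (Ca * 1 + θ * gr)
        - v ^ 2 * (W' * r + W * r')) - v * (Wt * r + W * (-J')))
    ≤ (v * (J - v * W * r) * (J' - v * (W' * r + W * r'))
        + (1/2 * v * W' * (J - v * r) ^ 2 + v * W * (J - v * r) * (J' - v * r')))
      - Ca * ((J - v * r) * (J - v * r)) - Ca * ((J - v * r) * (J - v * W * r))
      + 2 * θ * G * (nA * (|r| * |J - v * r|) + nr * ((J - v * r) * (J - v * r)))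
      + θ * v * S3 * G * (nJ * (r * r) + nr * (|J| * |r|))
      + S2 * (3/2 * v ^ 2 * (r * r) + 1/2 * (J * J))
      + 1/2 * v * S1 * (J * J + v ^ 2 * (r * r)) := by
  set A := J - v * r with hA
  have id : ((r * (Ca * v + θ * gJ) - J * (Ca * 1 + θ * gr) - v ^ 2 * (W' * r + W * r'))
        - v * (-J')) * (J - v * W * r)
      + A * ((r * (Ca * v + θ * gJ) - J * (Ca * 1 + θ * gr)
        - v ^ 2 * (W' * r + W * r')) - v * (Wt * r + W * (-J')))
      = (v * (J - v * W * r) * (J' - v * (W' * r + W * r'))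
        + (1/2 * v * W' * A ^ 2 + v * W * A * (J' - v * r')))
        - Ca * (A * A) - Ca * (A * (J - v * W * r))
        + 2 * θ * ((r * (gJ - v * gr) - A * gr) * A)
        + θ * v * ((r * gJ - J * gr) * (1 - W) * r)
        + (- Wt * (v * r * A)) + 1/2 * v * (- W' * (J * J - v ^ 2 * (r * r))) := by
    rw [hA]; ring
  rw [id]
  clear_value A
  clear id
  have b1 : (r * (gJ - v * gr) - A * gr) * A ≤ G * (nA * (|r| * |A|) + nr * (A * A)) := by
    have e1 : r * (gJ - v * gr) * A ≤ |r| * (G * nA) * |A| := by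
      refine (le_abs_self _).trans ?_
      rw [abs_mul, abs_mul]; gcongr
    have e2 : -(A * gr * A) ≤ |A| * (G * nr) * |A| := by
      refine (neg_le_abs _).trans ?_
      rw [abs_mul, abs_mul]; gcongr
    have e3 := abs_mul_abs_self A
    calc _ ≤ |r| * (G * nA) * |A| + (G * nr) * (|A| * |A|) := by linarith
      _ = _ := by rw [e3]; ring
  have hS3 : 0 ≤ S3 := (abs_nonneg _).trans hW
  have hGr : 0 ≤ G * nr := (abs_nonneg _).trans hgr
  have hGJ : 0 ≤ G * nJ := (abs_nonneg _).trans hgJ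
  have b2 : (r * gJ - J * gr) * (1 - W) * r ≤ S3 * G * (nJ * (r * r) + nr * (|J| * |r|)) := by
    have e0 : |r * gJ - J * gr| ≤ |r| * (G * nJ) + |J| * (G * nr) := by
      refine (abs_sub _ _).trans ?_
      rw [abs_mul, abs_mul]; gcongr
    refine (le_abs_self _).trans ?_
    rw [abs_mul, abs_mul]
    have e3 := abs_mul_abs_self r
    calc _ ≤ (|r| * (G * nJ) + |J| * (G * nr)) * S3 * |r| := by gcongr
      _ = S3 * G * (nJ * (|r| * |r|) + nr * (|J| * |r|)) := by ring
      _ = _ := by rw [e3]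
  have b3 : - Wt * (v * r * A) ≤ S2 * (3/2 * v ^ 2 * (r * r) + 1/2 * (J * J)) := by
    refine (le_abs_self _).trans ?_
    rw [abs_mul, abs_neg]
    have : |v * r * A| ≤ 3/2 * v ^ 2 * (r * r) + 1/2 * (J * J) := by
      have hA' : v * r * A = v * r * J - v * r * (v * r) := by rw [hA]; ring
      rw [hA', abs_le]
      constructor <;> nlinarith [sq_nonneg (v * r - J), sq_nonneg (v * r + J), sq_nonneg (v * r)]
    gcongr
    exact (abs_nonneg _).trans hWt
  have b4 : - W' * (J * J - v ^ 2 * (r * r)) ≤ S1 * (J * J + v ^ 2 * (r * r)) := by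
    refine (le_abs_self _).trans ?_
    rw [abs_mul, abs_neg]
    have : |J * J - v ^ 2 * (r * r)| ≤ J * J + v ^ 2 * (r * r) := by
      rw [abs_le]
      constructor <;> nlinarith [sq_nonneg J, sq_nonneg (v * r)]
    gcongr
    exact (abs_nonneg _).trans hW'
  have c1 : 2 * θ * ((r * (gJ - v * gr) - A * gr) * A)
      ≤ 2 * θ * G * (nA * (|r| * |A|) + nr * (A * A)) := by
    rw [mul_assoc (2 * θ) G]
    exact mul_le_mul_of_nonneg_left b1 (show 0 ≤ 2 * θ by positivity)
  have c2 : θ * v * ((r * gJ - J * gr) * (1 - W) * r)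
      ≤ θ * v * S3 * G * (nJ * (r * r) + nr * (|J| * |r|)) := by
    rw [mul_assoc (θ * v) S3 G, mul_assoc (θ * v)]
    exact mul_le_mul_of_nonneg_left b2 (show 0 ≤ θ * v by positivity)
  have c4 : 1/2 * v * (- W' * (J * J - v ^ 2 * (r * r)))
      ≤ 1/2 * v * S1 * (J * J + v ^ 2 * (r * r)) := by
    rw [mul_assoc (1/2 * v) S1]
    exact mul_le_mul_of_nonneg_left b4 (show 0 ≤ 1/2 * v by positivity)
  exact add_le_add (add_le_add (add_le_add (add_le_add le_rfl c1) c2) b3) c4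

lemma aux_fixed (Ca θ v Q S1 S2 S3 : ℝ) (hθ : 0 ≤ θ) (hv : 0 < v) (hQ : 0 < Q)
    (g r J W r' J' W' Wt : ℝ → ℝ) (hg : Continuous g) (hgp : Function.Periodic g (2*π))
    (hr : ∀ x, HasDerivAt r (r' x) x) (hJ : ∀ x, HasDerivAt J (J' x) x)
    (hW : ∀ x, HasDerivAt W (W' x) x) (cr' : Continuous r') (cJ' : Continuous J')
    (cW' : Continuous W') (cWt : Continuous Wt) (pr : Function.Periodic r (2*π))
    (pJ : Function.Periodic J (2*π)) (pW : Function.Periodic W (2*π))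
    (hS1 : ∀ x, |W' x| ≤ S1) (hS2 : ∀ x, |Wt x| ≤ S2) (hS3 : ∀ x, |1 - W x| ≤ S3)
    (mr : ∫ x in (0:ℝ)..(2*π), r x = 1) (mJ : ∫ x in (0:ℝ)..(2*π), J x = v)
    (hsm : 8 * θ * nrm g * Q < Ca)
    (hen : v ^ 2 * nrm r ^ 2 + nrm J ^ 2 ≤ v ^ 2 * Q ^ 2)
    (rt Jt : ℝ → ℝ) (hrt : ∀ x, rt x = - J' x)
    (hJt : ∀ x, Jt x = r x * conv1 (fun x => Ca + θ * g x) J x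
      - J x * conv1 (fun x => Ca + θ * g x) r x - v ^ 2 * (W' x * r x + W x * r' x)) :
    ∫ x in (0:ℝ)..(2*π), ((Jt x - v * rt x) * (J x - v * W x * r x)
      + (J x - v * r x) * (Jt x - v * (Wt x * r x + W x * rt x)))
    ≤ -Ca * ip (fun x => J x - v * r x) (fun x => J x - v * W x * r x)
      + (2 * v ^ 2 * Q ^ 2 * (v * S1 + S2) + v ^ 2 * θ * nrm g * Q ^ 3 * S3) := by
  have cr : Continuous r := continuous_iff_continuousAt.2 fun x => (hr x).continuousAt
  have cJ : Continuous J := continuous_iff_continuousAt.2 fun x => (hJ x).continuousAt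
  have cW : Continuous W := continuous_iff_continuousAt.2 fun x => (hW x).continuousAt
  have cgr := aux_conv_cont g r hg cr
  have cgJ := aux_conv_cont g J hg cJ
  set A : ℝ → ℝ := fun x => J x - v * r x with hAdef
  have cA : Continuous A := by fun_prop
  have hpi : (0:ℝ) ≤ 2*π := by positivity
  have hJt' : ∀ x, Jt x = r x * (Ca * v + θ * conv1 g J x) - J x * (Ca * 1 + θ * conv1 g r x)
      - v ^ 2 * (W' x * r x + W x * r' x) := fun x => by
    rw [hJt, aux_conv_const g J Ca θ hg cJ, aux_conv_const g r Ca θ hg cr, mr, mJ]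
  set D : ℝ → ℝ := fun x => v * (J x - v * W x * r x) * (J' x - v * (W' x * r x + W x * r' x))
        + (1/2 * v * W' x * (A x) ^ 2 + v * W x * A x * (J' x - v * r' x)) with hD
  have cD : Continuous D := by fun_prop
  have hDint : ∫ x in (0:ℝ)..(2*π), D x = 0 := by
    have : ∀ x ∈ Set.uIcc (0:ℝ) (2*π), HasDerivAt
        (fun x => 1/2 * v * (J x - v * (W x * r x)) ^ 2 + 1/2 * v * (W x * (J x - v * r x) ^ 2))
        (D x) x := by
      intro x _
      have h1 := ((((hJ x).sub (((hW x).mul (hr x)).const_mul v)).pow 2).const_mul (1/2 * v)).add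
        (((hW x).mul (((hJ x).sub ((hr x).const_mul v)).pow 2)).const_mul (1/2 * v))
      refine h1.congr_deriv ?_
      simp only [hD, hAdef, Pi.sub_apply, Pi.mul_apply, Pi.pow_apply]
      push_cast
      ring
    rw [intervalIntegral.integral_eq_sub_of_hasDerivAt this (aux_ii cD)]
    have e1 := pr 0
    have e2 := pJ 0
    have e3 := pW 0
    rw [zero_add] at e1 e2 e3
    rw [e1, e2, e3]; ring
  have hmono : ∫ x in (0:ℝ)..(2*π), ((Jt x - v * rt x) * (J x - v * W x * r x)
      + (J x - v * r x) * (Jt x - v * (Wt x * r x + W x * rt x)))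
      ≤ ∫ x in (0:ℝ)..(2*π), (D x - Ca * (A x * A x) - Ca * (A x * (J x - v * W x * r x))
      + 2 * θ * nrm g * (nrm A * (|r x| * |A x|) + nrm r * (A x * A x))
      + θ * v * S3 * nrm g * (nrm J * (r x * r x) + nrm r * (|J x| * |r x|))
      + S2 * (3/2 * v ^ 2 * (r x * r x) + 1/2 * (J x * J x))
      + 1/2 * v * S1 * (J x * J x + v ^ 2 * (r x * r x))) := by
    apply intervalIntegral.integral_mono_on hpi
    · simp only [hrt, hJt']
      exact aux_ii (by fun_prop)
    · exact aux_ii (by fun_prop)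
    · intro x _
      rw [hrt, hJt']
      refine aux_point (r x) (J x) (W x) (r' x) (J' x) (W' x) (Wt x) (conv1 g r x) (conv1 g J x)
        v θ Ca (nrm g) (nrm r) (nrm J) (nrm A) S1 S2 S3 hv hθ ?_ ?_ ?_ (hS1 x) (hS2 x) (hS3 x)
      · rw [← aux_conv_lin g J r v hg cJ cr]
        exact aux_conv g A hg hgp cA x
      · exact aux_conv g r hg hgp cr x
      · exact aux_conv g J hg hgp cJ x
  clear_value D
  have hsplit : ∫ x in (0:ℝ)..(2*π), (D x - Ca * (A x * A x) - Ca * (A x * (J x - v * W x * r x))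
      + 2 * θ * nrm g * (nrm A * (|r x| * |A x|) + nrm r * (A x * A x))
      + θ * v * S3 * nrm g * (nrm J * (r x * r x) + nrm r * (|J x| * |r x|))
      + S2 * (3/2 * v ^ 2 * (r x * r x) + 1/2 * (J x * J x))
      + 1/2 * v * S1 * (J x * J x + v ^ 2 * (r x * r x)))
      = (∫ x in (0:ℝ)..(2*π), D x) - Ca * ip A A - Ca * ip A (fun x => J x - v * W x * r x)
      + 2 * θ * nrm g * (nrm A * (∫ x in (0:ℝ)..(2*π), |r x| * |A x|) + nrm r * ip A A)
      + θ * v * S3 * nrm g * (nrm J * ip r r + nrm r * (∫ x in (0:ℝ)..(2*π), |J x| * |r x|))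
      + S2 * (3/2 * v ^ 2 * ip r r + 1/2 * ip J J)
      + 1/2 * v * S1 * (ip J J + v ^ 2 * ip r r) := by
    unfold ip
    rw [intervalIntegral.integral_add (aux_ii (by fun_prop)) (aux_ii (by fun_prop)),
      intervalIntegral.integral_add (aux_ii (by fun_prop)) (aux_ii (by fun_prop)),
      intervalIntegral.integral_add (aux_ii (by fun_prop)) (aux_ii (by fun_prop)),
      intervalIntegral.integral_add (aux_ii (by fun_prop)) (aux_ii (by fun_prop)),
      intervalIntegral.integral_sub (aux_ii (by fun_prop)) (aux_ii (by fun_prop)),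
      intervalIntegral.integral_sub (aux_ii (by fun_prop)) (aux_ii (by fun_prop))]
    simp only [intervalIntegral.integral_const_mul]
    rw [intervalIntegral.integral_add (aux_ii (by fun_prop)) (aux_ii (by fun_prop)),
      intervalIntegral.integral_add (aux_ii (by fun_prop)) (aux_ii (by fun_prop)),
      intervalIntegral.integral_add (aux_ii (by fun_prop)) (aux_ii (by fun_prop)),
      intervalIntegral.integral_add (aux_ii (by fun_prop)) (aux_ii (by fun_prop))]
    simp only [intervalIntegral.integral_const_mul]
  rw [hsplit, hDint] at hmono
  refine hmono.trans ?_
  have hS1' : 0 ≤ S1 := (abs_nonneg _).trans (hS1 0)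
  have hS2' : 0 ≤ S2 := (abs_nonneg _).trans (hS2 0)
  have hS3' : 0 ≤ S3 := (abs_nonneg _).trans (hS3 0)
  have hG := aux_nrm_nonneg g
  have hnr := aux_nrm_nonneg r
  have hnJ := aux_nrm_nonneg J
  have hnA := aux_nrm_nonneg A
  have k1 := aux_cs_abs r A cr cA
  have k2 := aux_cs_abs J r cJ cr
  have alg := aux_algebra v Q (nrm g) θ Ca (nrm r) (nrm J) (nrm A) S1 S2 S3 hv hQ hG hθ hnr hnJ
    hS1' hS2' hS3' hsm hen
  rw [← aux_nrm_sq A, ← aux_nrm_sq r, ← aux_nrm_sq J]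
  have l1 : 2 * θ * nrm g * (nrm A * (∫ x in (0:ℝ)..(2*π), |r x| * |A x|) + nrm r * nrm A ^ 2)
      ≤ 2 * θ * nrm g * (nrm A * (nrm r * nrm A) + nrm r * nrm A ^ 2) := by gcongr
  have l2 : θ * v * S3 * nrm g * (nrm J * nrm r ^ 2 + nrm r * (∫ x in (0:ℝ)..(2*π), |J x| * |r x|))
      ≤ θ * v * S3 * nrm g * (nrm J * nrm r ^ 2 + nrm r * (nrm J * nrm r)) := by gcongr
  linarith

lemma aux_final (v Q S : ℝ) (r J W : ℝ → ℝ) (cr : Continuous r) (cJ : Continuous J)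
    (cW : Continuous W) (hv : 0 < v) (hS : ∀ x, |W x - 1| ≤ S)
    (hen : v ^ 2 * nrm r ^ 2 + nrm J ^ 2 ≤ v ^ 2 * Q ^ 2) :
    nrm (fun x => J x - v * r x) ^ 2
      ≤ 2 * ip (fun x => J x - v * r x) (fun x => J x - v * W x * r x) + v ^ 2 * S ^ 2 * Q ^ 2 := by
  have hrQ : nrm r ^ 2 ≤ Q ^ 2 := by
    have : v ^ 2 * nrm r ^ 2 ≤ v ^ 2 * Q ^ 2 := by nlinarith [sq_nonneg (nrm J)]
    exact le_of_mul_le_mul_left this (by positivity)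
  have h : ip (fun x => J x - v * r x) (fun x => J x - v * r x)
      ≤ 2 * ip (fun x => J x - v * r x) (fun x => J x - v * W x * r x)
        + v ^ 2 * S ^ 2 * ip r r := by
    unfold ip
    rw [← intervalIntegral.integral_const_mul, ← intervalIntegral.integral_const_mul,
      ← intervalIntegral.integral_add (aux_ii (by fun_prop)) (aux_ii (by fun_prop))]
    apply intervalIntegral.integral_mono_on (by positivity) (aux_ii (by fun_prop))
      (aux_ii (by fun_prop))
    intro x _
    have h1 : (W x - 1) ^ 2 ≤ S ^ 2 := sq_le_sq' (by linarith [(abs_le.1 (hS x)).1]) (abs_le.1 (hS x)).2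
    have h2 := mul_le_mul_of_nonneg_right h1 (sq_nonneg (v * r x))
    nlinarith [sq_nonneg (J x - v * r x - v * (W x - 1) * r x)]
  rw [aux_nrm_sq]
  rw [← aux_nrm_sq r] at h
  have := mul_le_mul_of_nonneg_left hrQ (show 0 ≤ v ^ 2 * S ^ 2 by positivity)
  linarith

lemma aux_const (E : ℝ → ℝ) (T : ℝ) (hT : 0 < T) (hE : ContinuousOn E (Set.Icc 0 T))
    (hd : ∀ t ∈ Set.Ioo 0 T, HasDerivAt E 0 t) (t : ℝ) (ht : t ∈ Set.Icc 0 T) : E t = E 0 := by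
  have h1 := aux_gronwall E (fun _ => 0) (fun _ => 0) 0 T hT hE continuousOn_const hd
    (by simp) t ht
  have h2 := aux_gronwall (fun t => - E t) (fun _ => 0) (fun _ => 0) 0 T hT hE.neg
    continuousOn_const (fun t ht => (hd t ht).fun_neg.congr_deriv neg_zero) (by simp) t ht
  simp at h1 h2
  linarith

lemma aux_periodic_deriv (f : ℝ → ℝ) (hp : Function.Periodic f (2*π)) :
    Function.Periodic (fun x => deriv f x) (2*π) := by
  intro x
  have : (fun y => f (y + 2*π)) = f := funext hp
  have h := deriv_comp_add_const f (2*π) x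
  rw [this] at h
  exact h.symm

lemma aux_int_deriv_zero (f f' : ℝ → ℝ) (hf : ∀ x, HasDerivAt f (f' x) x) (cf : Continuous f')
    (hp : Function.Periodic f (2*π)) : ∫ x in (0:ℝ)..(2*π), f' x = 0 := by
  rw [intervalIntegral.integral_eq_sub_of_hasDerivAt (fun x _ => hf x) (aux_ii cf)]
  have := hp 0
  rw [zero_add] at this
  rw [this, sub_self]

/-- Proposition `local_result_w` (flocking bound \eqref{partial_flocking_alignment_b}):
flocking estimate for the weighted reduced Cucker-Smale PDE. -/
theorem stmt5 (Ca θ : ℝ) (hCa : 0 < Ca) (hθ : 0 ≤ θ)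
    (g : ℝ → ℝ) (hg_cont : Continuous g) (hg_per : Function.Periodic g (2*π))
    (a : ℝ → ℝ) (ha : a = fun x => Ca + θ * g x)
    (ha_even : ∀ x, a (-x) = a x) (ha_pos : ∀ x, 0 < a x)
    (vbar : ℝ) (hvbar : 0 < vbar) (T : ℝ) (hT : 0 < T)
    (w : ℝ → ℝ → ℝ)
    (hw_per : ∀ t ∈ Set.Icc (0:ℝ) T, Function.Periodic (fun x => w x t) (2*π))
    (hw_smooth : ContDiffOn ℝ (⊤ : ℕ∞) (fun p : ℝ × ℝ => w p.1 p.2) (Set.univ ×ˢ Set.Icc (0:ℝ) T))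
    (wmin wmax : ℝ) (hwmin : 0 < wmin)
    (hw_bounds : ∀ (x : ℝ), ∀ t ∈ Set.Icc (0:ℝ) T, wmin ≤ w x t ∧ w x t ≤ wmax)
    (ρ j : ℝ → ℝ → ℝ) (hsol : IsWeightedSol a vbar w ρ j (Set.Icc 0 T))
    (hmass_rho : (∫ x in (0:ℝ)..(2*π), ρ x 0) = 1)
    (hmass_j : (∫ x in (0:ℝ)..(2*π), j x 0) = vbar)
    (Q : ℝ) (hQ : 0 < Q) (hQsmall : 8 * θ * nrm g * Q < Ca)
    (henergy : ∀ t ∈ Set.Icc (0:ℝ) T,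
      vbar ^ 2 * nrm (fun x => ρ x t) ^ 2 + nrm (fun x => j x t) ^ 2 ≤ vbar ^ 2 * Q ^ 2)
    (betaT : ℝ → ℝ)
    (hbetaT : ∀ s, betaT s =
      2 * vbar ^ 2 * Q ^ 2 * (vbar * supNorm (fun x => deriv (fun y => w y s) x)
          + supNorm (fun x => derivWithin (fun τ => w x τ) (Set.Icc (0:ℝ) T) s))
        + vbar ^ 2 * θ * nrm g * Q ^ 3 * supNorm (fun x => 1 - w x s))
    (beta : ℝ → ℝ)
    (hbeta : ∀ t, beta t =
      2 * Real.exp (-Ca * t) * (∫ s in (0:ℝ)..t, Real.exp (Ca * s) * betaT s)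
        + vbar ^ 2 * supNorm (fun x => w x t - 1) ^ 2 * Q ^ 2) :
    ∀ t ∈ Set.Icc (0:ℝ) T,
      nrm (fun x => j x t - vbar * ρ x t) ^ 2 ≤
        2 * |ip (fun x => j x 0 - vbar * ρ x 0) (fun x => j x 0 - vbar * w x 0 * ρ x 0)|
            * Real.exp (-Ca * t)
          + beta t := by
  subst ha
  obtain ⟨pr, pJ, sr, sJ, hpr, hpJ⟩ := hsol
  obtain ⟨rx, rt, crx, crt⟩ := aux_reg ρ T hT sr
  obtain ⟨jx, jt, cjx, cjt⟩ := aux_reg j T hT sJ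
  obtain ⟨wx, wt, cwx, cwt⟩ := aux_reg w T hT hw_smooth
  have cr := sr.continuousOn
  have cj := sJ.continuousOn
  have cw := hw_smooth.continuousOn
  have ca : Continuous (fun x => Ca + θ * g x) := by fun_prop
  -- mass conservation
  have mr : ∀ t ∈ Set.Icc 0 T, ∫ x in (0:ℝ)..(2*π), ρ x t = 1 := by
    intro t ht
    rw [← hmass_rho]
    refine aux_const (fun t => ∫ x in (0:ℝ)..(2*π), ρ x t) T hT (aux_cont_int ρ T hT cr) ?_ t ht
    intro s hs
    have hs' := Set.Ioo_subset_Icc_self hs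
    refine (aux_deriv_int ρ _ T hT cr crt rt s hs).congr_deriv ?_
    simp only [hpr _ s hs', intervalIntegral.integral_neg]
    rw [aux_int_deriv_zero (fun x => j x s) _ (fun x => jx x s hs')
      (aux_slice (fun x t => deriv (fun y => j y t) x) T cjx s hs') (pJ s hs'), neg_zero]
  have prodd : ∀ x, ∀ t ∈ Set.Icc 0 T, HasDerivAt (fun y => w y t * ρ y t)
      (deriv (fun y => w y t) x * ρ x t + w x t * deriv (fun y => ρ y t) x) x :=
    fun x t ht => (wx x t ht).mul (rx x t ht)
  have mj : ∀ t ∈ Set.Icc 0 T, ∫ x in (0:ℝ)..(2*π), j x t = vbar := by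
    intro t ht
    rw [← hmass_j]
    refine aux_const (fun t => ∫ x in (0:ℝ)..(2*π), j x t) T hT (aux_cont_int j T hT cj) ?_ t ht
    intro s hs
    have hs' := Set.Ioo_subset_Icc_self hs
    have c1 := aux_slice ρ T cr s hs'
    have c2 := aux_slice j T cj s hs'
    have c3 := aux_slice w T cw s hs'
    have c4 := aux_slice (fun x t => deriv (fun y => w y t) x) T cwx s hs'
    have c5 := aux_slice (fun x t => deriv (fun y => ρ y t) x) T crx s hs'
    have c6 := aux_conv_cont _ _ ca c1
    have c7 := aux_conv_cont _ _ ca c2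
    refine (aux_deriv_int j _ T hT cj cjt jt s hs).congr_deriv ?_
    simp only [hpJ _ s hs', (prodd _ s hs').deriv]
    rw [intervalIntegral.integral_sub (aux_ii (by fun_prop)) (aux_ii (by fun_prop)),
      intervalIntegral.integral_sub (aux_ii (by fun_prop)) (aux_ii (by fun_prop)),
      intervalIntegral.integral_const_mul,
      aux_int_deriv_zero (fun y => w y s * ρ y s) _ (fun x => prodd x s hs') (by fun_prop)
        (fun x => by
          have e1 := hw_per s hs' x
          have e2 := pr s hs' x
          simp only at e1 e2 ⊢
          rw [e1, e2]),
      aux_conv_swap _ (fun y => ρ y s) (fun y => j y s) ca ha_even c1 c2]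
    simp
  -- periodicity of the derivatives of the weight
  have pwx : ∀ t ∈ Set.Icc 0 T, Function.Periodic (fun x => deriv (fun y => w y t) x) (2*π) :=
    fun t ht => aux_periodic_deriv _ (hw_per t ht)
  have pwt : ∀ t ∈ Set.Icc 0 T, Function.Periodic
      (fun x => derivWithin (fun τ => w x τ) (Set.Icc (0:ℝ) T) t) (2*π) := by
    intro t ht x
    exact derivWithin_congr (fun s hs => hw_per s hs x) (hw_per t ht x)
  have pw1 : ∀ t ∈ Set.Icc 0 T, Function.Periodic (fun x => 1 - w x t) (2*π) := by
    intro t ht x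
    have := hw_per t ht x
    simp only at this ⊢
    rw [this]
  have pw2 : ∀ t ∈ Set.Icc 0 T, Function.Periodic (fun x => w x t - 1) (2*π) := by
    intro t ht x
    have := hw_per t ht x
    simp only at this ⊢
    rw [this]
  have cw1 : ContinuousOn (fun p : ℝ × ℝ => 1 - w p.1 p.2) (Set.univ ×ˢ Set.Icc (0:ℝ) T) :=
    continuousOn_const.sub cw
  have cb : ContinuousOn betaT (Set.Icc 0 T) := by
    rw [show betaT = _ from funext hbetaT]
    have d1 := aux_sup_cont (fun x s => deriv (fun y => w y s) x) T hT cwx pwx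
    have d2 := aux_sup_cont (fun x s => derivWithin (fun τ => w x τ) (Set.Icc (0:ℝ) T) s) T hT
      cwt pwt
    have d3 := aux_sup_cont (fun x s => 1 - w x s) T hT cw1 pw1
    exact (continuousOn_const.mul ((continuousOn_const.mul d1).add d2)).add
      (continuousOn_const.mul d3)
  -- Gronwall
  set F : ℝ → ℝ → ℝ := fun x t => (j x t - vbar * ρ x t) * (j x t - vbar * w x t * ρ x t) with hF
  set Dt : (ℝ → ℝ → ℝ) → ℝ → ℝ → ℝ := fun f x t =>
    derivWithin (fun s => f x s) (Set.Icc (0:ℝ) T) t with hDt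
  set Ft : ℝ → ℝ → ℝ := fun x t =>
    (Dt j x t - vbar * Dt ρ x t) * (j x t - vbar * w x t * ρ x t)
      + (j x t - vbar * ρ x t) * (Dt j x t - vbar * (Dt w x t * ρ x t + w x t * Dt ρ x t)) with hFt
  have cF : ContinuousOn (fun p : ℝ × ℝ => F p.1 p.2) (Set.univ ×ˢ Set.Icc (0:ℝ) T) :=
    (cj.sub (continuousOn_const.mul cr)).mul (cj.sub ((continuousOn_const.mul cw).mul cr))
  have cFt : ContinuousOn (fun p : ℝ × ℝ => Ft p.1 p.2) (Set.univ ×ˢ Set.Icc (0:ℝ) T) :=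
    ((cjt.sub (continuousOn_const.mul crt)).mul (cj.sub ((continuousOn_const.mul cw).mul cr))).add
      ((cj.sub (continuousOn_const.mul cr)).mul
        (cjt.sub (continuousOn_const.mul ((cwt.mul cr).add (cw.mul crt)))))
  have hdF : ∀ x, ∀ t ∈ Set.Icc (0:ℝ) T, HasDerivWithinAt (fun s => F x s) (Ft x t)
      (Set.Icc (0:ℝ) T) t := by
    intro x t ht
    have := ((jt x t ht).sub ((rt x t ht).const_mul vbar)).mul
      ((jt x t ht).sub (((wt x t ht).const_mul vbar).mul (rt x t ht)))
    refine this.congr_deriv ?_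
    simp only [hFt, hDt, Pi.sub_apply, Pi.mul_apply]
    ring
  intro t ht
  have hgr := aux_gronwall (fun t => ∫ x in (0:ℝ)..(2*π), F x t)
    (fun t => ∫ x in (0:ℝ)..(2*π), Ft x t) betaT Ca T hT (aux_cont_int F T hT cF) cb
    (fun s hs => aux_deriv_int F Ft T hT cF cFt hdF s hs) (by
      intro s hs
      have hs' := Set.Ioo_subset_Icc_self hs
      rw [hbetaT]
      have c4 := aux_slice (fun x t => deriv (fun y => w y t) x) T cwx s hs'
      have c5 := aux_slice (fun x t => deriv (fun y => ρ y t) x) T crx s hs'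
      have c6 := aux_slice (fun x t => deriv (fun y => j y t) x) T cjx s hs'
      have c7 := aux_slice (fun x t => Dt w x t) T cwt s hs'
      have c8 := aux_slice (fun x t => 1 - w x t) T cw1 s hs'
      refine aux_fixed Ca θ vbar Q _ _ _ hθ hvbar hQ g (fun x => ρ x s) (fun x => j x s)
        (fun x => w x s) _ _ _ (fun x => Dt w x s) hg_cont hg_per (fun x => rx x s hs')
        (fun x => jx x s hs') (fun x => wx x s hs') c5 c6 c4 c7 (pr s hs') (pJ s hs')
        (hw_per s hs') (fun x => aux_sup_le _ c4 (pwx s hs') x)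
        (fun x => aux_sup_le _ c7 (pwt s hs') x)
        (fun x => aux_sup_le (fun x => 1 - w x s) c8 (pw1 s hs') x) (mr s hs') (mj s hs') hQsmall
        (henergy s hs') (fun x => Dt ρ x s) (fun x => Dt j x s) (fun x => hpr x s hs')
        (fun x => ?_)
      have := hpJ x s hs'
      rw [(prodd x s hs').deriv] at this
      exact this) t ht
  have hfin := aux_final vbar Q (supNorm (fun x => w x t - 1)) (fun x => ρ x t) (fun x => j x t)
    (fun x => w x t) (aux_slice ρ T cr t ht) (aux_slice j T cj t ht) (aux_slice w T cw t ht) hvbar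
    (fun x => aux_sup_le (fun x => w x t - 1) ((aux_slice w T cw t ht).sub continuous_const)
      (pw2 t ht) x) (henergy t ht)
  rw [hbeta]
  refine hfin.trans ?_
  change ip (fun x => j x t - vbar * ρ x t) (fun x => j x t - vbar * w x t * ρ x t) ≤
    Real.exp (-Ca * t) * (ip (fun x => j x 0 - vbar * ρ x 0)
      (fun x => j x 0 - vbar * w x 0 * ρ x 0) + _) at hgr
  have habs := mul_le_mul_of_nonneg_left (le_abs_self (ip (fun x => j x 0 - vbar * ρ x 0)
    (fun x => j x 0 - vbar * w x 0 * ρ x 0))) (Real.exp_pos (-Ca * t)).le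
  linarith
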